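/- Fix 3 ≤ p ≤ n − 1 and assume λ_1 > … > λ_n > 0. Then all eigenvalues of the Jacobian of the arbitrary-eigenpair system at the equilibrium (v_p, λ_p) are strictly negative (they are −1 with multiplicity p+1 and λ_p⁻¹λ_k − 1 < 0 for k = p+1,…,n), so (v_p, λ_p) is a linearly stable equilibrium. -/

import Mathlib

open Matrix

/-- The right-hand side of the coupled learning rule for the `p`-th eigenpair
(`0`-based index `p`). -/
noncomputable def arbSys {n : ℕ} (C : Matrix (Fin n) (Fin n) ℝ)
    (v : Fin n → (Fin n → ℝ)) (lam : Fin n → ℝ) (p : Fin n)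
    (x : (Fin n → ℝ) × ℝ) : (Fin n → ℝ) × ℝ :=
  (x.2⁻¹ • (C *ᵥ x.1 - (x.1 ⬝ᵥ C *ᵥ x.1) • x.1) + ((x.1 ⬝ᵥ x.1 - 1) / 2) • x.1
      - (∑ i ∈ Finset.univ.filter (fun i : Fin n => i < p),
          ((lam i - x.2)⁻¹ + x.2⁻¹) • Matrix.vecMulVec (v i) (v i)) *ᵥ
        (C *ᵥ x.1 - x.2 • x.1),
   x.1 ⬝ᵥ C *ᵥ x.1 - x.2 * (x.1 ⬝ᵥ x.1))

/-- The `(n+1) × (n+1)` matrix of a continuous linear map on `ℝⁿ × ℝ` with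
respect to the standard basis. -/
noncomputable def clmMatrix {n : ℕ}
    (L : ((Fin n → ℝ) × ℝ) →L[ℝ] ((Fin n → ℝ) × ℝ)) :
    Matrix (Fin n ⊕ Unit) (Fin n ⊕ Unit) ℝ :=
  Matrix.of fun i j =>
    Sum.elim
      (fun i' => (L (Sum.elim (fun j' => (Pi.single j' (1 : ℝ), (0 : ℝ)))
        (fun _ => (0, 1)) j)).1 i')
      (fun _ => (L (Sum.elim (fun j' => (Pi.single j' (1 : ℝ), (0 : ℝ)))
        (fun _ => (0, 1)) j)).2) i

theorem HasFDerivAt.dotProduct {ι E : Type*} [Fintype ι] [NormedAddCommGroup E]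
    [NormedSpace ℝ E] {f g : E → ι → ℝ} {f' g' : E →L[ℝ] ι → ℝ} {x : E}
    (hf : HasFDerivAt f f' x) (hg : HasFDerivAt g g' x) :
    HasFDerivAt (fun y => f y ⬝ᵥ g y)
      (∑ i, (f x i • (ContinuousLinearMap.proj i ∘L g') +
        g x i • (ContinuousLinearMap.proj i ∘L f'))) x :=
  HasFDerivAt.fun_sum fun i _ => (hasFDerivAt_pi'.1 hf i).mul (hasFDerivAt_pi'.1 hg i)

theorem HasFDerivAt.const_mulVec {ι κ E : Type*} [Fintype ι] [Fintype κ]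
    [NormedAddCommGroup E] [NormedSpace ℝ E] (A : Matrix κ ι ℝ) {f : E → ι → ℝ}
    {f' : E →L[ℝ] ι → ℝ} {x : E} (hf : HasFDerivAt f f' x) :
    HasFDerivAt (fun y => A *ᵥ f y)
      (LinearMap.toContinuousLinearMap A.mulVecLin ∘L f') x :=
  (LinearMap.toContinuousLinearMap A.mulVecLin).hasFDerivAt.comp x hf

theorem HasFDerivAt.smul_of_eq_zero {E F : Type*} [NormedAddCommGroup E] [NormedSpace ℝ E]
    [NormedAddCommGroup F] [NormedSpace ℝ F] {c : E → ℝ} {f : E → F} {f' : E →L[ℝ] F} {x : E}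
    (hc : DifferentiableAt ℝ c x) (hf : HasFDerivAt f f' x) (h0 : f x = 0) :
    HasFDerivAt (fun y => c y • f y) (c x • f') x := by
  refine (hc.hasFDerivAt.smul hf).congr_fderiv ?_
  ext y
  simp [h0]

theorem Matrix.IsSymm.dotProduct_mulVec_of_eigenvector {ι : Type*} [Fintype ι]
    {C : Matrix ι ι ℝ} (hC : C.IsSymm) {w : ι → ℝ} {μ : ℝ} (hw : C *ᵥ w = μ • w) (u : ι → ℝ) :
    w ⬝ᵥ C *ᵥ u = μ * (w ⬝ᵥ u) := by
  rw [Matrix.dotProduct_mulVec, ← Matrix.mulVec_transpose, hC.eq, hw, smul_dotProduct,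
    smul_eq_mul]

/-- The Jacobian of `arbSys` at `(v p, lam p)`, as a linear map. -/
theorem exists_hasFDerivAt_arbSys {n : ℕ} {C : Matrix (Fin n) (Fin n) ℝ} (hC : C.IsSymm)
    {v : Fin n → (Fin n → ℝ)} {lam : Fin n → ℝ}
    (horth : ∀ i j, v i ⬝ᵥ v j = if i = j then (1 : ℝ) else 0)
    (heig : ∀ k, C *ᵥ v k = lam k • v k) {p : Fin n} (hp : lam p ≠ 0)
    (hne : ∀ i, i < p → lam i ≠ lam p) :
    ∃ L : ((Fin n → ℝ) × ℝ) →L[ℝ] ((Fin n → ℝ) × ℝ),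
      HasFDerivAt (arbSys C v lam p) L (v p, lam p) ∧
      ∀ u m, L (u, m) =
        ((lam p)⁻¹ • (C *ᵥ u - lam p • u) - (v p ⬝ᵥ u) • v p
          - ∑ i ∈ Finset.univ.filter (fun i : Fin n => i < p),
            (((lam i - lam p)⁻¹ + (lam p)⁻¹) * (v i ⬝ᵥ (C *ᵥ u - lam p • u))) • v i, -m) := by
  have hfst : HasFDerivAt (fun x : (Fin n → ℝ) × ℝ => x.1)
      (ContinuousLinearMap.fst ℝ (Fin n → ℝ) ℝ) (v p, lam p) := hasFDerivAt_fst
  have hsnd : HasFDerivAt (fun x : (Fin n → ℝ) × ℝ => x.2)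
      (ContinuousLinearMap.snd ℝ (Fin n → ℝ) ℝ) (v p, lam p) := hasFDerivAt_snd
  have hquad := hfst.dotProduct (hfst.const_mulVec C)
  have hsq := hfst.dotProduct hfst
  have hres := (hfst.const_mulVec C).fun_sub (hsnd.fun_smul hfst)
  have hone : v p ⬝ᵥ v p = 1 := by simp [horth]
  have hinv : DifferentiableAt ℝ (fun x : (Fin n → ℝ) × ℝ => x.2⁻¹) (v p, lam p) :=
    hsnd.differentiableAt.fun_inv hp
  have hterm (i : Fin n) (hi : i ∈ Finset.univ.filter (fun i : Fin n => i < p)) :=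
    HasFDerivAt.smul_of_eq_zero
      (c := fun x : (Fin n → ℝ) × ℝ => (lam i - x.2)⁻¹ + x.2⁻¹)
      (((hsnd.differentiableAt.const_sub (lam i)).fun_inv
        (sub_ne_zero.2 (hne i (Finset.mem_filter.1 hi).2))).fun_add hinv)
      (hres.const_mulVec (Matrix.vecMulVec (v i) (v i))) (by simp [heig])
  have hmain := (((HasFDerivAt.smul_of_eq_zero hinv
      ((hfst.const_mulVec C).fun_sub (hquad.fun_smul hfst)) (by simp [heig, hone])).fun_add
      (((hsq.sub_const 1).mul_const (2⁻¹ : ℝ)).fun_smul hfst)).fun_sub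
      (HasFDerivAt.fun_sum hterm)).prodMk (hquad.fun_sub (hsnd.fun_mul hsq))
  refine ⟨_, hmain.congr_of_eventuallyEq (.of_forall fun x => ?_), fun u m => ?_⟩
  · simp [arbSys, Matrix.sum_mulVec, Matrix.smul_mulVec, div_eq_mul_inv]
  · have hsymm : v p ⬝ᵥ C *ᵥ u = lam p * (v p ⬝ᵥ u) :=
      hC.dotProduct_mulVec_of_eigenvector (heig p) u
    have hquad' : ∑ i, (v p i * (C *ᵥ u) i + lam p * v p i * u i) = 2 * lam p * (v p ⬝ᵥ u) := by
      simp only [Finset.sum_add_distrib, mul_assoc, ← Finset.mul_sum]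
      change v p ⬝ᵥ C *ᵥ u + lam p * (v p ⬝ᵥ u) = _
      rw [hsymm]
      ring
    have hsq' : ∑ i, (v p i * u i + v p i * u i) = 2 * (v p ⬝ᵥ u) := by
      rw [Finset.sum_add_distrib, two_mul, dotProduct]
    refine Prod.ext (funext fun j => ?_) ?_
    · simp only [ContinuousLinearMap.prod_apply, _root_.sum_apply, heig, hone,
        _root_.add_apply, _root_.sub_apply,
        _root_.smul_apply, ContinuousLinearMap.comp_apply,
        ContinuousLinearMap.smulRight_apply, ContinuousLinearMap.proj_apply,
        ContinuousLinearMap.coe_fst', ContinuousLinearMap.coe_snd',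
        LinearMap.coe_toContinuousLinearMap', Matrix.mulVecLin_apply, dotProduct_smul,
        Pi.add_apply, Pi.sub_apply, Pi.smul_apply, Finset.sum_apply, smul_eq_mul, hquad', hsq',
        Matrix.vecMulVec_mulVec, op_smul_eq_smul]
      have hterms (i : Fin n) (hi : i ∈ Finset.univ.filter (fun i : Fin n => i < p)) :
          v i ⬝ᵥ (C *ᵥ u - (lam p • u + m • v p)) = v i ⬝ᵥ (C *ᵥ u - lam p • u) := by
        simp [dotProduct_sub, dotProduct_add, horth, (Finset.mem_filter.1 hi).2.ne]
      rw [Finset.sum_congr rfl fun i hi => by rw [hterms i hi, ← mul_assoc]]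
      field_simp
      ring
    · simp [heig, hone, hquad', hsq']
      ring

theorem clmMatrix_mulVec {n : ℕ} (L : ((Fin n → ℝ) × ℝ) →L[ℝ] ((Fin n → ℝ) × ℝ))
    (u : Fin n → ℝ) (m : ℝ) :
    clmMatrix L *ᵥ Sum.elim u (fun _ => m) = Sum.elim (L (u, m)).1 (fun _ => (L (u, m)).2) := by
  have hu : (u, m) = ∑ j, u j • ((Pi.single j (1 : ℝ), (0 : ℝ)) : (Fin n → ℝ) × ℝ) +
      m • (0, 1) := by
    ext j
    · simp [Prod.fst_sum, Finset.sum_apply, Pi.single_apply]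
    · simp [Prod.snd_sum]
  simp only [hu, map_add, map_sum, map_smul]
  ext (i | i) <;>
    simp [clmMatrix, Matrix.mulVec, dotProduct, Prod.fst_sum, Prod.snd_sum, mul_comm]

theorem exists_eigenvector_of_mem_spectrum_clmMatrix {n : ℕ}
    {L : ((Fin n → ℝ) × ℝ) →L[ℝ] ((Fin n → ℝ) × ℝ)} {α : ℝ}
    (hα : α ∈ spectrum ℝ (clmMatrix L)) : ∃ u m, (u, m) ≠ 0 ∧ L (u, m) = α • (u, m) := by
  rw [spectrum.mem_iff, Matrix.isUnit_iff_isUnit_det, isUnit_iff_ne_zero, not_not,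
    ← Matrix.exists_mulVec_eq_zero_iff] at hα
  obtain ⟨x, hx, hx0⟩ := hα
  obtain ⟨u, m, rfl⟩ : ∃ u m, x = Sum.elim u (fun _ : Unit => m) :=
    ⟨x ∘ Sum.inl, x (Sum.inr ()), by ext (i | i) <;> rfl⟩
  rw [Matrix.sub_mulVec, clmMatrix_mulVec, sub_eq_zero, Algebra.algebraMap_eq_smul_one,
    Matrix.smul_mulVec, Matrix.one_mulVec] at hx0
  refine ⟨u, m, fun h => hx ?_, ?_⟩
  · obtain ⟨rfl, rfl⟩ := Prod.mk_eq_zero.1 h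
    ext (i | i) <;> rfl
  · ext i
    · simpa using (congrFun hx0 (Sum.inl i)).symm
    · simpa using (congrFun hx0 (Sum.inr ())).symm

theorem eq_zero_of_forall_dotProduct_eq_zero_of_orthonormal {ι : Type*} [Fintype ι]
    [DecidableEq ι] {v : ι → (ι → ℝ)}
    (horth : ∀ i j, v i ⬝ᵥ v j = if i = j then (1 : ℝ) else 0) {u : ι → ℝ}
    (hu : ∀ k, v k ⬝ᵥ u = 0) : u = 0 := by
  have hV : Matrix.of v * (Matrix.of v)ᵀ = 1 := by
    ext i j
    exact (horth i j).trans (Matrix.one_apply ..).symm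
  have hVu : Matrix.of v *ᵥ u = 0 := funext hu
  rw [← Matrix.one_mulVec u, ← mul_eq_one_comm.1 hV, ← Matrix.mulVec_mulVec, hVu,
    Matrix.mulVec_zero]

/-- For positive, strictly decreasing eigenvalues, all
eigenvalues of the Jacobian of the arbitrary-eigenpair system at `(v_p, λ_p)`
are strictly negative (they are `−1` with multiplicity `p+1` and
`λ_p⁻¹ λ_k − 1 < 0` for `k > p`), so `(v_p, λ_p)` is a linearly stable
equilibrium. -/
theorem arbitrary_eigenpair_stable_at_p
    (n : ℕ) (hn : 4 ≤ n)
    (C : Matrix (Fin n) (Fin n) ℝ) (hC : C.IsSymm)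
    (v : Fin n → (Fin n → ℝ)) (lam : Fin n → ℝ)
    (horth : ∀ i j, v i ⬝ᵥ v j = if i = j then (1 : ℝ) else 0)
    (heig : ∀ k, C *ᵥ v k = lam k • v k)
    (hdec : StrictAnti lam) (hpos : ∀ k, 0 < lam k)
    (p : Fin n) (hp2 : 2 ≤ (p : ℕ)) (hpn : (p : ℕ) ≤ n - 2) :
    ∃ L : ((Fin n → ℝ) × ℝ) →L[ℝ] ((Fin n → ℝ) × ℝ),
      HasFDerivAt (arbSys C v lam p) L (v p, lam p) ∧
      (∀ k : Fin n, p < k → (lam p)⁻¹ * lam k - 1 < 0) ∧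
      (∀ α ∈ spectrum ℝ (clmMatrix L), α < 0) := by
  have hp := (hpos p).ne'
  have hright (k : Fin n) (hk : p < k) : (lam p)⁻¹ * lam k - 1 < 0 := by
    rw [sub_neg, inv_mul_lt_one₀ (hpos p)]
    exact hdec hk
  obtain ⟨L, hL, hLapply⟩ := exists_hasFDerivAt_arbSys hC horth heig hp fun i hi => (hdec hi).ne'
  refine ⟨L, hL, hright, fun α hα => ?_⟩
  obtain ⟨u, m, hne, hum⟩ := exists_eigenvector_of_mem_spectrum_clmMatrix hα
  rw [hLapply] at hum
  obtain ⟨hu, hm⟩ := Prod.ext_iff.1 hum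
  by_contra! hα0
  have hm0 : m = 0 := by
    have : (α + 1) * m = 0 := by
      simp only [Prod.smul_mk, smul_eq_mul] at hm
      linarith
    exact (mul_eq_zero.1 this).resolve_left (by linarith)
  refine hne (Prod.mk_eq_zero.2
    ⟨eq_zero_of_forall_dotProduct_eq_zero_of_orthonormal horth fun k => ?_, hm0⟩)
  have hres (i : Fin n) :
      v i ⬝ᵥ (C *ᵥ u - lam p • u) = (lam i - lam p) * (v i ⬝ᵥ u) := by
    rw [dotProduct_sub, hC.dotProduct_mulVec_of_eigenvector (heig i), dotProduct_smul,
      smul_eq_mul, sub_mul]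
  have hk := congrArg (v k ⬝ᵥ ·) hu
  simp only [dotProduct_sub (v k) (_ - _), dotProduct_sub (v k) (_ • _), dotProduct_smul,
    dotProduct_sum, hres, horth, Prod.smul_mk, smul_eq_mul, mul_ite, mul_one, mul_zero,
    Finset.sum_ite_eq, Finset.mem_filter, Finset.mem_univ, true_and] at hk
  rcases lt_trichotomy k p with hkp | rfl | hkp
  · have hsub : lam k - lam p ≠ 0 := sub_ne_zero.2 (hdec hkp).ne'
    rw [if_neg hkp.ne, if_pos hkp] at hk
    have : (α + 1) * (v k ⬝ᵥ u) = 0 := by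
      rw [add_mul, ← hk]
      field_simp
      ring
    exact (mul_eq_zero.1 this).resolve_left (by linarith)
  · have : (α + 1) * (v k ⬝ᵥ u) = 0 := by
      rw [add_mul, ← hk]
      simp
    exact (mul_eq_zero.1 this).resolve_left (by linarith)
  · rw [if_neg hkp.ne', if_neg hkp.not_gt] at hk
    have : (α - ((lam p)⁻¹ * lam k - 1)) * (v k ⬝ᵥ u) = 0 := by
      rw [sub_mul, ← hk]
      field_simp
      ring
    exact (mul_eq_zero.1 this).resolve_left (by linarith [hright k hkp])
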